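/- arXiv:2003.04977 — 3 statements merged into one kernel-verified Lean document; each statement's English description precedes it below -/
import Mathlib

section
/- Let d₁, d₂ ≥ 1, let 1 ≤ i ≤ d₁, and set d = d₁ + d₂ − 1. The affine maps ι₁ : |Δ^{d₁}| → |Δ^d| and ι₂ : |Δ^{d₂}| → |Δ^d| induced by the strictly monotone vertex maps f₁ and f₂ are injective, and the intersection of their images, ι₁(|Δ^{d₁}|) ∩ ι₂(|Δ^{d₂}|), is precisely the closed edge {s·e_{i−1} + (1−s)·e_{i+d₂−1} : s ∈ [0,1]} of |Δ^d| joining the (i−1)st vertex to the (i+d₂−1)st vertex. In other words, the two simplicial inclusions encoding the gluing map #ᵢ : |Δ^{d₂}| ⊔ |Δ^{d₁}| → |Δ^{d₂+d₁−1}| overlap along exactly one edge of |Δ^{d₂+d₁−1}|. -/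
section InducedMaps

variable {α β : Type*} [Fintype α] [DecidableEq β]
  {f : α → β} {ι : (α → ℝ) → (β → ℝ)}

/-- The map induced by an injective vertex map reads off the original coordinates. -/
lemma induced_apply_vertex (hf : Function.Injective f)
    (hι : ∀ t j, ι t j = ∑ k, if f k = j then t k else 0) (t : α → ℝ) (k : α) :
    ι t (f k) = t k := by
  classical
  simp [hι, hf.eq_iff]

lemma induced_injective (hf : Function.Injective f)
    (hι : ∀ t j, ι t j = ∑ k, if f k = j then t k else 0) : Function.Injective ι := by
  intro s t hst
  ext k
  rw [← induced_apply_vertex hf hι s, hst, induced_apply_vertex hf hι]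

/-- The image of the standard simplex under an injective vertex map is the face spanned by the
range of that vertex map. -/
lemma induced_image_stdSimplex [Fintype β] (hf : Function.Injective f)
    (hι : ∀ t j, ι t j = ∑ k, if f k = j then t k else 0) :
    ι '' stdSimplex ℝ α = {x | x ∈ stdSimplex ℝ β ∧ ∀ j, j ∉ Set.range f → x j = 0} := by
  have hzero : ∀ t j, j ∉ Set.range f → ι t j = 0 := fun t j hj ↦ by
    rw [hι]
    exact Finset.sum_eq_zero fun k _ ↦ if_neg fun h ↦ hj ⟨k, h⟩
  ext x
  constructor
  · rintro ⟨t, ⟨ht₀, ht₁⟩, rfl⟩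
    refine ⟨⟨fun j ↦ ?_, ?_⟩, hzero t⟩
    · rw [hι]
      exact Finset.sum_nonneg fun k _ ↦ by split_ifs <;> simp [ht₀]
    · simp only [hι]
      rw [Finset.sum_comm]
      simpa using ht₁
  · rintro ⟨⟨hx₀, hx₁⟩, hx⟩
    have hιx : ι (x ∘ f) = x := by
      ext j
      by_cases hj : j ∈ Set.range f
      · obtain ⟨k, rfl⟩ := hj
        exact induced_apply_vertex hf hι _ k
      · rw [hzero _ j hj, hx j hj]
    refine ⟨x ∘ f, ⟨fun k ↦ hx₀ _, ?_⟩, hιx⟩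
    rw [← hx₁]
    exact Fintype.sum_of_injective f hf _ _ hx fun _ ↦ rfl

end InducedMaps

/-- The points of the standard simplex supported on two distinct vertices form the closed edge
joining these vertices. -/
lemma stdSimplex_supported_on_pair {β : Type*} [Fintype β] [DecidableEq β] {a b : β}
    (hab : a ≠ b) :
    {x | x ∈ stdSimplex ℝ β ∧ ∀ j, j ≠ a → j ≠ b → x j = 0} =
      {x | ∃ s : ℝ, s ∈ Set.Icc (0 : ℝ) 1 ∧
        x = s • (Pi.single a (1 : ℝ) : β → ℝ) + (1 - s) • (Pi.single b (1 : ℝ) : β → ℝ)} := by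
  ext x
  constructor
  · rintro ⟨⟨hx₀, hx₁⟩, hx⟩
    have hsum : x a + x b = 1 := by
      rw [← hx₁, Fintype.sum_eq_add a b hab fun j hj ↦ hx j hj.1 hj.2]
    refine ⟨x a, ⟨hx₀ a, by linarith [hx₀ b]⟩, ?_⟩
    ext j
    by_cases hja : j = a
    · subst hja
      simp [hab]
    · by_cases hjb : j = b
      · subst hjb
        simp only [Pi.add_apply, Pi.smul_apply, Pi.single_eq_same, Pi.single_eq_of_ne hja,
          smul_eq_mul]
        linarith
      · simp [hja, hjb, hx j hja hjb]
  · rintro ⟨s, ⟨hs₀, hs₁⟩, rfl⟩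
    refine ⟨convex_stdSimplex ℝ β (single_mem_stdSimplex ℝ a) (single_mem_stdSimplex ℝ b) hs₀
      (by linarith) (by ring), fun j hja hjb ↦ by simp [hja, hjb]⟩


open Finset in
/-- The simplicial inclusions `ι₁ : |Δ^{d₁}| → |Δ^d|` and `ι₂ : |Δ^{d₂}| → |Δ^d|`
(`d = d₁ + d₂ - 1`) induced by the gluing vertex maps `f₁, f₂` are injective on the standard
simplices, and their images intersect exactly in the closed edge of `|Δ^d|` joining the
`(i-1)`-st vertex to the `(i+d₂-1)`-st vertex. -/
theorem glued_simplicial_inclusions_overlap_in_edge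
    (d₁ d₂ i : ℕ) (hd₁ : 1 ≤ d₁) (hd₂ : 1 ≤ d₂) (hi₁ : 1 ≤ i) (hi₂ : i ≤ d₁)
    (f₁ : Fin (d₁ + 1) → Fin (d₁ + d₂)) (f₂ : Fin (d₂ + 1) → Fin (d₁ + d₂))
    (hf₁ : ∀ k : Fin (d₁ + 1),
      (f₁ k : ℕ) = if (k : ℕ) ≤ i - 1 then (k : ℕ) else (k : ℕ) + d₂ - 1)
    (hf₂ : ∀ k : Fin (d₂ + 1), (f₂ k : ℕ) = i - 1 + (k : ℕ))
    (ι₁ : (Fin (d₁ + 1) → ℝ) → (Fin (d₁ + d₂) → ℝ))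
    (ι₂ : (Fin (d₂ + 1) → ℝ) → (Fin (d₁ + d₂) → ℝ))
    (hι₁ : ∀ t, ∀ j, ι₁ t j = ∑ k : Fin (d₁ + 1), if f₁ k = j then t k else 0)
    (hι₂ : ∀ t, ∀ j, ι₂ t j = ∑ k : Fin (d₂ + 1), if f₂ k = j then t k else 0) :
    Set.InjOn ι₁ (stdSimplex ℝ (Fin (d₁ + 1))) ∧
    Set.InjOn ι₂ (stdSimplex ℝ (Fin (d₂ + 1))) ∧
    (ι₁ '' stdSimplex ℝ (Fin (d₁ + 1))) ∩ (ι₂ '' stdSimplex ℝ (Fin (d₂ + 1))) =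
      {x | ∃ s : ℝ, s ∈ Set.Icc (0 : ℝ) 1 ∧
        x = s • (Pi.single (⟨i - 1, by omega⟩ : Fin (d₁ + d₂)) (1 : ℝ) : Fin (d₁ + d₂) → ℝ) +
          (1 - s) • (Pi.single (⟨i + d₂ - 1, by omega⟩ : Fin (d₁ + d₂)) (1 : ℝ) :
            Fin (d₁ + d₂) → ℝ)} := by
  have hinj₁ : Function.Injective f₁ := fun k l hkl ↦ by
    have h := congrArg Fin.val hkl
    rw [hf₁, hf₁] at h
    ext
    split_ifs at h <;> omega
  have hinj₂ : Function.Injective f₂ := fun k l hkl ↦ by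
    have h := congrArg Fin.val hkl
    rw [hf₂, hf₂] at h
    ext
    omega
  refine ⟨(induced_injective hinj₁ hι₁).injOn, (induced_injective hinj₂ hι₂).injOn, ?_⟩
  rw [induced_image_stdSimplex hinj₁ hι₁, induced_image_stdSimplex hinj₂ hι₂,
    ← stdSimplex_supported_on_pair (by rw [Ne, Fin.mk.injEq]; omega)]
  ext x
  constructor
  · rintro ⟨⟨hx, h₁⟩, -, h₂⟩
    refine ⟨hx, fun j hja hjb ↦ ?_⟩
    rw [Ne, Fin.ext_iff] at hja hjb
    by_cases hj : j ∈ Set.range f₁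
    · refine h₂ j ?_
      rintro ⟨l, rfl⟩
      obtain ⟨k, hk⟩ := hj
      have h := congrArg Fin.val hk
      have hl := l.isLt
      rw [hf₁, hf₂] at h
      simp only [hf₂] at hja hjb
      split_ifs at h <;> omega
    · exact h₁ j hj
  · rintro ⟨hx, h⟩
    refine ⟨⟨hx, fun j hj ↦ h j ?_ ?_⟩, hx, fun j hj ↦ h j ?_ ?_⟩
    · rintro rfl
      refine hj ⟨⟨i - 1, by omega⟩, Fin.ext ?_⟩
      simp [hf₁]
    · rintro rfl
      refine hj ⟨⟨i, by omega⟩, Fin.ext ?_⟩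
      rw [hf₁, if_neg (by simp only; omega)]
    · rintro rfl
      refine hj ⟨⟨0, by omega⟩, Fin.ext ?_⟩
      simp [hf₂]
    · rintro rfl
      refine hj ⟨⟨d₂, by omega⟩, Fin.ext ?_⟩
      simp only [hf₂]
      omega
end

section
/- For every d ≥ 1 there exist, for each j ∈ {0,…,d}, a relatively open subset U_j ⊆ |Δ^d| containing the codimension-one face F_j and a smooth retraction π_j : U_j → F_j (that is, π_j is smooth, takes values in F_j, and fixes F_j pointwise), such that the neighborhoods are mutually small in the following sense: for any two nonempty subsets S, S' ⊆ {0,…,d} with S ∩ S' = ∅ (equivalently, with disjoint closed subsimplices Δ_S ∩ Δ_{S'} = ∅), the sets 𝒰_S = ⋂_{j ∉ S} U_j and 𝒰_{S'} = ⋂_{j ∉ S'} U_j are disjoint. -/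
section RadialProjection

variable {ι : Type*} [DecidableEq ι]

/-- The projection away from the `j`-th vertex onto the hyperplane `t j = 0`, which preserves
the sum of the coordinates of points whose coordinates sum to `1`. -/
noncomputable def radialProjection (j : ι) (x : ι → ℝ) : ι → ℝ :=
  (1 - x j)⁻¹ • Function.update x j 0

lemma radialProjection_apply_self (j : ι) (x : ι → ℝ) : radialProjection j x j = 0 := by
  simp [radialProjection]

lemma radialProjection_eq_self {j : ι} {x : ι → ℝ} (hx : x j = 0) :
    radialProjection j x = x := by
  have h : Function.update x j 0 = x := by rw [← hx, Function.update_eq_self]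
  simp [radialProjection, h, hx]

variable [Fintype ι]

lemma radialProjection_mem_face {j : ι} {x : ι → ℝ} (hx : x ∈ stdSimplex ℝ ι) (hxj : x j < 1) :
    radialProjection j x ∈ {t ∈ stdSimplex ℝ ι | t j = 0} := by
  have hpos : 0 < 1 - x j := sub_pos.2 hxj
  refine ⟨⟨fun i => ?_, ?_⟩, radialProjection_apply_self j x⟩
  · refine mul_nonneg (inv_nonneg.2 hpos.le) ?_
    rcases eq_or_ne i j with rfl | hij
    · simp
    · simpa [Function.update_of_ne hij] using hx.1 i
  · have hsum : ∑ i, Function.update x j 0 i = 1 - x j := by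
      rw [Finset.sum_update_of_mem (Finset.mem_univ j), zero_add, eq_sub_iff_add_eq, ← hx.2,
        Finset.sum_sdiff_eq_sub (Finset.subset_univ _)]
      simp
    simp only [radialProjection, Pi.smul_apply, smul_eq_mul]
    rw [← Finset.mul_sum, hsum, inv_mul_cancel₀ hpos.ne']

lemma contDiffOn_radialProjection (j : ι) {n : WithTop ℕ∞} :
    ContDiffOn ℝ n (radialProjection j) {x | x j ≠ 1} := by
  have hcoord (i : ι) : ContDiff ℝ n fun x : ι → ℝ => x i := contDiff_apply ℝ ℝ i
  refine ContDiffOn.smul (ContDiffOn.inv (contDiff_const.sub (hcoord j)).contDiffOn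
    fun x hx => sub_ne_zero.2 (Ne.symm hx)) (contDiff_pi.2 fun i => ?_).contDiffOn
  rcases eq_or_ne i j with rfl | hij
  · simpa using contDiff_const
  · simpa [Function.update_of_ne hij] using hcoord i

end RadialProjection


/-- Existence of collars of the codimension-one faces of the standard `d`-simplex:
for every `d ≥ 1` there are relatively open neighborhoods `U j` of the faces
`F j = {t ∈ |Δ^d| : t j = 0}` together with smooth retractions `π j : U j → F j`
(smooth in the sense of extending to a `C^∞` map on an open neighborhood), such that
for any two disjoint nonempty index sets `S, S'` (equivalently, disjoint closed
subsimplices), the intersections `𝒰_S = ⋂_{j ∉ S} U j` and `𝒰_{S'} = ⋂_{j ∉ S'} U j`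
are disjoint. -/
theorem simplicial_collars_exist (d : ℕ) (hd : 1 ≤ d) :
    ∃ (U : Fin (d + 1) → Set (Fin (d + 1) → ℝ))
      (π : Fin (d + 1) → (Fin (d + 1) → ℝ) → (Fin (d + 1) → ℝ)),
      (∀ j,
        -- `U j` is a relatively open subset of the simplex containing the face `F j`
        (∃ V : Set (Fin (d + 1) → ℝ), IsOpen V ∧
          U j = V ∩ stdSimplex ℝ (Fin (d + 1))) ∧
        {t ∈ stdSimplex ℝ (Fin (d + 1)) | t j = 0} ⊆ U j ∧
        -- `π j` retracts `U j` onto the face `F j`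
        (∀ x ∈ U j, π j x ∈ {t ∈ stdSimplex ℝ (Fin (d + 1)) | t j = 0}) ∧
        (∀ x ∈ {t ∈ stdSimplex ℝ (Fin (d + 1)) | t j = 0}, π j x = x) ∧
        -- `π j` is smooth: it extends to a `C^∞` map on an open neighborhood of `U j`
        (∃ (W : Set (Fin (d + 1) → ℝ)) (g : (Fin (d + 1) → ℝ) → (Fin (d + 1) → ℝ)),
          IsOpen W ∧ U j ⊆ W ∧ ContDiffOn ℝ (⊤ : ℕ∞) g W ∧ ∀ x ∈ U j, g x = π j x)) ∧
      -- the neighborhoods are mutually small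
      (∀ S S' : Finset (Fin (d + 1)), S.Nonempty → S'.Nonempty → S ∩ S' = ∅ →
        (⋂ j ∈ {j | j ∉ S}, U j) ∩ (⋂ j ∈ {j | j ∉ S'}, U j) = ∅) := by
  have hd' : (1 : ℝ) / (d + 1) < 1 := by
    rw [div_lt_one (by positivity)]
    have : (1 : ℝ) ≤ d := by exact_mod_cast hd
    linarith
  have hpos : (0 : ℝ) < 1 / (d + 1) := by positivity
  have hopen (j : Fin (d + 1)) : IsOpen {t : Fin (d + 1) → ℝ | t j < 1 / (d + 1)} :=
    isOpen_lt (continuous_apply j) continuous_const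
  refine ⟨fun j => {t | t j < 1 / (d + 1)} ∩ stdSimplex ℝ (Fin (d + 1)),
    radialProjection, fun j => ⟨⟨_, hopen j, rfl⟩, ?_, ?_, ?_, ?_⟩, ?_⟩
  · rintro t ⟨ht, htj⟩
    exact ⟨by simpa only [Set.mem_ofPred_eq, htj] using hpos, ht⟩
  · rintro x ⟨hxj, hx⟩
    exact radialProjection_mem_face hx (lt_trans hxj hd')
  · rintro x ⟨-, hxj⟩
    exact radialProjection_eq_self hxj
  · exact ⟨{t | t j < 1 / (d + 1)}, radialProjection j, hopen j, Set.inter_subset_left,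
      (contDiffOn_radialProjection j).mono fun t ht => (lt_trans ht hd').ne, fun _ _ => rfl⟩
  · intro S S' _ _ hSS'
    rw [Set.eq_empty_iff_forall_notMem]
    rintro x ⟨hxS, hxS'⟩
    simp only [Set.mem_iInter, Set.mem_ofPred_eq] at hxS hxS'
    have hx (j : Fin (d + 1)) : x j < 1 / (d + 1) ∧ x ∈ stdSimplex ℝ (Fin (d + 1)) := by
      by_cases hj : j ∈ S
      · refine hxS' j fun hj' => ?_
        have := Finset.mem_inter.2 ⟨hj, hj'⟩
        simp [hSS'] at this
      · exact hxS j hj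
    have hlt : ∑ j, x j < ∑ _j : Fin (d + 1), (1 : ℝ) / (d + 1) :=
      Finset.sum_lt_sum_of_nonempty Finset.univ_nonempty fun j _ => (hx j).1
    have hcard : ∑ _j : Fin (d + 1), (1 : ℝ) / (d + 1) = 1 := by
      simp only [Finset.sum_const, Finset.card_univ, Fintype.card_fin, nsmul_eq_mul]
      push_cast
      field_simp
    rw [hcard, (hx 0).2.2] at hlt
    exact lt_irrefl _ hlt
end

section
/- Let a < b, w > 0, and let u : ℝ² → ℝ be twice continuously differentiable on a neighborhood of the closed rectangle Q = [a,b] × [0,w]. Assume Δu ≥ 0 on Q, and assume ∂u/∂t(τ,0) ≥ 0 and ∂u/∂t(τ,w) ≤ 0 for all τ ∈ (a,b) (i.e. the outward normal derivative of u is nonpositive along the two horizontal boundary edges). Then the maximum of u over Q is attained on the two vertical edges: for every (τ,t) ∈ Q one has u(τ,t) ≤ sup { u(σ,s) : σ ∈ {a,b}, s ∈ [0,w] }. -/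
open Set Filter Topology

theorem deriv_deriv_nonpos_of_isLocalMax {f : ℝ → ℝ} {x : ℝ} (hf : IsLocalMax f x)
    (hc : ContinuousAt f x) : deriv (deriv f) x ≤ 0 := by
  by_contra! hpos
  have hmin := isLocalMin_of_deriv_deriv_pos hpos hf.deriv_eq_zero hc
  have hconst : f =ᶠ[𝓝 x] fun _ => f x := by
    filter_upwards [hf, hmin] with y h₁ h₂ using le_antisymm h₁ h₂
  have hzero : deriv (deriv f) x = 0 := by
    rw [hconst.deriv.deriv_eq]
    simp
  exact hpos.ne' hzero

theorem hasDerivAt_const_mul_sub_sq (c d x : ℝ) :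
    HasDerivAt (fun y => c * (y - d) ^ 2) (2 * c * (x - d)) x := by
  have h := (((hasDerivAt_id x).sub_const d).pow 2).const_mul c
  refine h.congr_deriv ?_
  simp
  ring

/-- Second derivative test for a function perturbed by a quadratic. -/
theorem deriv_deriv_add_two_mul_nonpos_of_isLocalMax {f : ℝ → ℝ} {x c d : ℝ}
    (hf : ContDiffAt ℝ 2 f x) (hmax : IsLocalMax (fun y => f y + c * (y - d) ^ 2) x) :
    deriv (deriv f) x + 2 * c ≤ 0 := by
  have hdiff : ∀ᶠ y in 𝓝 x, DifferentiableAt ℝ f y :=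
    (hf.eventually (by simp)).mono fun y hy => hy.differentiableAt (by simp)
  have hderiv : deriv (fun y => f y + c * (y - d) ^ 2) =ᶠ[𝓝 x]
      fun y => deriv f y + 2 * c * (y - d) := by
    filter_upwards [hdiff] with y hy
    exact (hy.hasDerivAt.add (hasDerivAt_const_mul_sub_sq c d y)).deriv
  have hf' : DifferentiableAt ℝ (deriv f) x :=
    ((hf.fderiv_right (m := 1) (by norm_num)).differentiableAt (by simp)).clm_apply
      (differentiableAt_const (1 : ℝ))
  have hlin : HasDerivAt (fun y => 2 * c * (y - d)) (2 * c) x := by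
    simpa using ((hasDerivAt_id x).sub_const d).const_mul (2 * c)
  have hcont : ContinuousAt (fun y => f y + c * (y - d) ^ 2) x :=
    hf.continuousAt.add (hasDerivAt_const_mul_sub_sq c d x).continuousAt
  have h := deriv_deriv_nonpos_of_isLocalMax hmax hcont
  rw [hderiv.deriv_eq] at h
  exact (hf'.hasDerivAt.add hlin).deriv.symm.le.trans h

theorem HasDerivAt.nonpos_of_isMaxOn_Icc_left {f : ℝ → ℝ} {f' x y : ℝ} (hxy : x < y)
    (hf : HasDerivAt f f' x) (hmax : IsMaxOn f (Icc x y) x) : f' ≤ 0 := by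
  have h := hmax.localize.hasFDerivWithinAt_nonpos hf.hasFDerivAt.hasFDerivWithinAt
    (sub_mem_posTangentConeAt_of_segment_subset (segment_eq_Icc hxy.le).subset)
  rw [ContinuousLinearMap.toSpanSingleton_apply, smul_eq_mul] at h
  exact nonpos_of_mul_nonpos_right h (sub_pos.2 hxy)

theorem HasDerivAt.nonneg_of_isMaxOn_Icc_right {f : ℝ → ℝ} {f' x y : ℝ} (hxy : x < y)
    (hf : HasDerivAt f f' y) (hmax : IsMaxOn f (Icc x y) y) : 0 ≤ f' := by
  have h := hmax.localize.hasFDerivWithinAt_nonpos hf.hasFDerivAt.hasFDerivWithinAt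
    (sub_mem_posTangentConeAt_of_segment_subset
      ((segment_symm ℝ y x).trans (segment_eq_Icc hxy.le)).subset)
  rw [ContinuousLinearMap.toSpanSingleton_apply, smul_eq_mul] at h
  exact nonneg_of_mul_nonpos_right h (sub_neg.2 hxy)

/-- Maximum principle on a rectangle `Q = [a,b] × [0,w]`: if `u` is `C²` on a neighborhood
of `Q`, subharmonic on `Q` (`Δu ≥ 0`), and its outward normal derivative is nonpositive
along the two horizontal edges (`∂u/∂t(τ,0) ≥ 0` and `∂u/∂t(τ,w) ≤ 0` for `τ ∈ (a,b)`),
then the maximum of `u` over `Q` is attained on the two vertical edges. -/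
theorem rectangle_max_principle_subharmonic
    (a b w : ℝ) (hab : a < b) (hw : 0 < w)
    (u : ℝ → ℝ → ℝ)
    -- `u` is twice continuously differentiable on an open neighborhood of the rectangle
    (V : Set (ℝ × ℝ)) (hV : IsOpen V)
    (hVQ : (Set.Icc a b ×ˢ Set.Icc (0 : ℝ) w) ⊆ V)
    (hu : ContDiffOn ℝ 2 (fun p : ℝ × ℝ => u p.1 p.2) V)
    -- `Δu ≥ 0` on the rectangle
    (hlap : ∀ τ ∈ Set.Icc a b, ∀ t ∈ Set.Icc (0 : ℝ) w,
      0 ≤ deriv (deriv fun σ => u σ t) τ + deriv (deriv (u τ)) t)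
    -- nonpositive outward normal derivative along the horizontal edges
    (hbot : ∀ τ ∈ Set.Ioo a b, deriv (u τ) 0 ≥ 0)
    (htop : ∀ τ ∈ Set.Ioo a b, deriv (u τ) w ≤ 0) :
    ∀ τ ∈ Set.Icc a b, ∀ t ∈ Set.Icc (0 : ℝ) w,
      u τ t ≤ sSup ((fun p : ℝ × ℝ => u p.1 p.2) ''
        (({a, b} : Set ℝ) ×ˢ Set.Icc (0 : ℝ) w)) := by
  intro τ hτ t ht
  set S := sSup ((fun p : ℝ × ℝ => u p.1 p.2) '' (({a, b} : Set ℝ) ×ˢ Icc (0 : ℝ) w))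
  have hcompact : IsCompact (Icc a b ×ˢ Icc (0 : ℝ) w) := isCompact_Icc.prod isCompact_Icc
  have hcont : ContinuousOn (fun p : ℝ × ℝ => u p.1 p.2) (Icc a b ×ˢ Icc (0 : ℝ) w) :=
    hu.continuousOn.mono hVQ
  have hedge : ({a, b} : Set ℝ) ×ˢ Icc (0 : ℝ) w ⊆ Icc a b ×ˢ Icc (0 : ℝ) w := by
    refine prod_mono ?_ subset_rfl
    rintro x (rfl | rfl)
    exacts [left_mem_Icc.2 hab.le, right_mem_Icc.2 hab.le]
  have hle : ∀ σ ∈ ({a, b} : Set ℝ), ∀ s ∈ Icc (0 : ℝ) w, u σ s ≤ S := fun σ hσ s hs =>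
    le_csSup ((hcompact.bddAbove_image hcont).mono (image_mono hedge))
      (mem_image_of_mem (fun p : ℝ × ℝ => u p.1 p.2) (mk_mem_prod hσ hs))
  have hreg : ∀ σ ∈ Icc a b, ∀ s ∈ Icc (0 : ℝ) w,
      ContDiffAt ℝ 2 (fun x => u x s) σ ∧ ContDiffAt ℝ 2 (u σ) s := by
    intro σ hσ s hs
    have h : ContDiffAt ℝ 2 (fun p : ℝ × ℝ => u p.1 p.2) (σ, s) :=
      hu.contDiffAt (hV.mem_nhds (hVQ (mk_mem_prod hσ hs)))
    exact ⟨h.comp σ (contDiffAt_id.prodMk contDiffAt_const),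
      h.comp s (contDiffAt_const.prodMk contDiffAt_id)⟩
  -- Perturb `u` by a quadratic with positive Laplacian and the right strict boundary signs.
  have key : ∀ ε > 0, u τ t ≤ S + ε * (2 * (b - a) ^ 2 + w ^ 2) := by
    intro ε hε
    obtain ⟨⟨σ, s⟩, ⟨hσ, hs⟩, hmax⟩ := hcompact.exists_isMaxOn
      (f := fun p : ℝ × ℝ => u p.1 p.2 + 2 * ε * (p.1 - a) ^ 2 + -ε * (p.2 - w / 2) ^ 2)
      ⟨(τ, t), hτ, ht⟩ (by fun_prop)
    replace hmax : ∀ x ∈ Icc a b, ∀ y ∈ Icc (0 : ℝ) w,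
        u x y + 2 * ε * (x - a) ^ 2 + -ε * (y - w / 2) ^ 2 ≤
          u σ s + 2 * ε * (σ - a) ^ 2 + -ε * (s - w / 2) ^ 2 :=
      fun x hx y hy => hmax (mk_mem_prod hx hy)
    simp only at hσ hs
    have hvert : IsMaxOn (fun y => u σ y + -ε * (y - w / 2) ^ 2) (Icc 0 w) s :=
      fun y hy => by simpa using by linarith [hmax σ hσ y hy]
    have hhor : IsMaxOn (fun x => u x s + 2 * ε * (x - a) ^ 2) (Icc a b) σ :=
      fun x hx => by simpa using by linarith [hmax x hx s hs]
    obtain ⟨hregx, hregy⟩ := hreg σ hσ s hs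
    have hσ_edge : σ ∈ ({a, b} : Set ℝ) := by
      by_contra hne
      simp only [mem_insert_iff, mem_singleton_iff, not_or] at hne
      have hσ' : σ ∈ Ioo a b :=
        ⟨lt_of_le_of_ne hσ.1 (Ne.symm hne.1), lt_of_le_of_ne hσ.2 hne.2⟩
      have hd := (hregy.differentiableAt (by simp)).hasDerivAt.add
        (hasDerivAt_const_mul_sub_sq (-ε) (w / 2) s)
      have hεw := mul_pos hε hw
      rcases hs.1.eq_or_lt with rfl | hs0
      · have := HasDerivAt.nonpos_of_isMaxOn_Icc_left hw hd hvert
        linarith [hbot σ hσ']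
      rcases hs.2.eq_or_lt with rfl | hsw
      · have := HasDerivAt.nonneg_of_isMaxOn_Icc_right hw hd hvert
        linarith [htop σ hσ']
      have hx := deriv_deriv_add_two_mul_nonpos_of_isLocalMax hregx
        (hhor.isLocalMax (Icc_mem_nhds hσ'.1 hσ'.2))
      have hy := deriv_deriv_add_two_mul_nonpos_of_isLocalMax hregy
        (hvert.isLocalMax (Icc_mem_nhds hs0 hsw))
      linarith [hlap σ hσ s hs]
    have h₁ := hmax τ hτ t ht
    have h₂ := hle σ hσ_edge s hs
    have h₃ : (σ - a) ^ 2 ≤ (b - a) ^ 2 :=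
      pow_le_pow_left₀ (sub_nonneg.2 hσ.1) (by linarith [hσ.2]) 2
    have h₄ : (t - w / 2) ^ 2 ≤ w ^ 2 :=
      sq_le_sq' (by linarith [ht.1]) (by linarith [ht.2])
    nlinarith [mul_le_mul_of_nonneg_left h₃ hε.le, mul_le_mul_of_nonneg_left h₄ hε.le,
      mul_nonneg hε.le (sq_nonneg (τ - a)), mul_nonneg hε.le (sq_nonneg (s - w / 2))]
  have hC : 0 < 2 * (b - a) ^ 2 + w ^ 2 := by positivity
  refine le_of_forall_pos_le_add fun δ hδ => ?_
  simpa [div_mul_cancel₀ δ hC.ne'] using key (δ / (2 * (b - a) ^ 2 + w ^ 2)) (div_pos hδ hC)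
end
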